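/- Let Δ be a simply-laced root system in a finite-dimensional real inner product space and let Γ be a subgroup of the Weyl group W(Δ). Then Γ is large if and only if condition (A) holds: for all α, β ∈ Δ such that α + β ∈ Δ, at least one of the reflections s_α, s_β, s_{α+β} belongs to Γ. (Equivalence established in the proof of Proposition 5.2.6.) -/

import Mathlib

open RealInnerProductSpace

/-- The reflection `s_α(x) = x − (2⟨x,α⟩/⟨α,α⟩)α` as a function. -/
noncomputable def sFun {V : Type*} [NormedAddCommGroup V] [InnerProductSpace ℝ V]
    (α : V) : V → V :=
  fun x => x - (2 * ⟪x, α⟫ / ⟪α, α⟫) • α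

/-- The Weyl group of `Δ`: the subgroup of the orthogonal group of `V` generated by the
reflections `s_α`, `α ∈ Δ`. -/
noncomputable def weylGroup {V : Type*} [NormedAddCommGroup V] [InnerProductSpace ℝ V]
    (Δ : Set V) : Subgroup (V ≃ₗᵢ[ℝ] V) :=
  Subgroup.closure { w : V ≃ₗᵢ[ℝ] V | ∃ α ∈ Δ, ∀ x, w x = sFun α x }

/-- `s_γ ∈ Γ`: some element of `Γ` acts as the reflection `s_γ`. -/
def reflMem {V : Type*} [NormedAddCommGroup V] [InnerProductSpace ℝ V]
    (Γ : Subgroup (V ≃ₗᵢ[ℝ] V)) (γ : V) : Prop :=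
  ∃ w ∈ Γ, ∀ x, w x = sFun γ x

/-- `Γ` is large: for any roots `α, β` with `β ≠ ±α` and `⟨α,β⟩ ≠ 0` there is a nonzero
`γ ∈ ℝα + ℝβ` with `s_γ ∈ Γ`. -/
def IsLarge {V : Type*} [NormedAddCommGroup V] [InnerProductSpace ℝ V]
    (Δ : Set V) (Γ : Subgroup (V ≃ₗᵢ[ℝ] V)) : Prop :=
  ∀ α ∈ Δ, ∀ β ∈ Δ, β ≠ α → β ≠ -α → ⟪α, β⟫ ≠ 0 →
    ∃ γ : V, γ ≠ 0 ∧ (∃ s t : ℝ, γ = s • α + t • β) ∧ reflMem Γ γ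

section Reflections

variable {V : Type*} [NormedAddCommGroup V] [InnerProductSpace ℝ V]

lemma sFun_neg_right (δ y : V) : sFun δ (-y) = -sFun δ y := by
  simp only [sFun, inner_neg_left, mul_neg, neg_div, neg_smul]
  abel

lemma sFun_self {δ : V} (hδ : δ ≠ 0) : sFun δ δ = -δ := by
  have h : ⟪δ, δ⟫ ≠ 0 := inner_self_ne_zero.mpr hδ
  rw [sFun, mul_div_assoc, div_self h]
  module

lemma sFun_sFun {δ : V} (hδ : δ ≠ 0) (y : V) : sFun δ (sFun δ y) = y := by
  have h : ⟪δ, δ⟫ ≠ 0 := inner_self_ne_zero.mpr hδ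
  have e : 2 * ⟪sFun δ y, δ⟫ / ⟪δ, δ⟫ = -(2 * ⟪y, δ⟫ / ⟪δ, δ⟫) := by
    simp only [sFun, inner_sub_left, real_inner_smul_left]
    field_simp
    ring
  rw [sFun, e, sFun]
  module

lemma inner_sFun_right (δ a y : V) : ⟪a, sFun δ y⟫ = ⟪sFun δ a, y⟫ := by
  simp only [sFun, inner_sub_left, inner_sub_right, real_inner_smul_left, real_inner_smul_right]
  rw [real_inner_comm y δ]
  ring

lemma sFun_smul {c : ℝ} (hc : c ≠ 0) (γ y : V) : sFun (c • γ) y = sFun γ y := by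
  by_cases hγ : γ = 0
  · simp [hγ]
  have h : ⟪γ, γ⟫ ≠ 0 := inner_self_ne_zero.mpr hγ
  simp only [sFun, real_inner_smul_left, real_inner_smul_right, smul_smul]
  congr 2
  field_simp

lemma sFun_eq_reflection (γ y : V) : sFun γ y = (ℝ ∙ γ)ᗮ.reflection y := by
  rw [Submodule.reflection_orthogonal_apply, Submodule.reflection_singleton_apply, sFun,
    real_inner_self_eq_norm_sq, real_inner_comm]
  simp only [RCLike.ofReal_real_eq_id, id_eq]
  module

lemma reflMem_congr {Γ : Subgroup (V ≃ₗᵢ[ℝ] V)} {γ δ : V} (h : ∀ y, sFun γ y = sFun δ y) :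
    reflMem Γ γ ↔ reflMem Γ δ := by
  simp only [reflMem, h]

lemma reflMem_smul {Γ : Subgroup (V ≃ₗᵢ[ℝ] V)} {c : ℝ} (hc : c ≠ 0) (γ : V) :
    reflMem Γ (c • γ) ↔ reflMem Γ γ :=
  reflMem_congr (sFun_smul hc γ)

lemma reflMem_neg {Γ : Subgroup (V ≃ₗᵢ[ℝ] V)} (γ : V) : reflMem Γ (-γ) ↔ reflMem Γ γ := by
  simpa using reflMem_smul (Γ := Γ) (show (-1 : ℝ) ≠ 0 by norm_num) γ

lemma neg_mem_of_sFun_mem {Δ : Set V} (h0 : (0 : V) ∉ Δ)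
    (hrefl : ∀ α ∈ Δ, ∀ β ∈ Δ, sFun α β ∈ Δ) {α : V} (hα : α ∈ Δ) : -α ∈ Δ := by
  have h := hrefl α hα α hα
  rwa [sFun_self (fun h => h0 (h ▸ hα))] at h

lemma det_eq_neg_one_of_sFun [FiniteDimensional ℝ V] {γ : V} (hγ : γ ≠ 0) (w : V ≃ₗᵢ[ℝ] V)
    (hw : ∀ x, w x = sFun γ x) :
    LinearMap.det (w.toLinearEquiv : V →ₗ[ℝ] V) = -1 := by
  have e : w = (ℝ ∙ γ)ᗮ.reflection := by
    ext x
    rw [hw, sFun_eq_reflection]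
  have h := Submodule.det_reflection (𝕜 := ℝ) (ℝ ∙ γ)ᗮ
  rw [Submodule.orthogonal_orthogonal, finrank_span_singleton hγ, pow_one] at h
  rw [e]
  exact h

/-- A root reflection changes the sign of the product of the positive roots. -/
lemma prod_pos_sFun {Δ : Set V} (hfin : Δ.Finite) (h0 : (0 : V) ∉ Δ)
    (hrefl : ∀ α ∈ Δ, ∀ β ∈ Δ, sFun α β ∈ Δ)
    (hred : ∀ α ∈ Δ, ∀ t : ℝ, t • α ∈ Δ → t • α = α ∨ t • α = -α)
    {x : V} (hx : ∀ α ∈ Δ, ⟪α, x⟫ ≠ 0) {δ : V} (hδ : δ ∈ Δ) (y : V) :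
    ∏ α ∈ hfin.toFinset with 0 < ⟪α, x⟫, ⟪α, sFun δ y⟫ =
      -∏ α ∈ hfin.toFinset with 0 < ⟪α, x⟫, ⟪α, y⟫ := by
  classical
  wlog hpos : 0 < ⟪δ, x⟫ generalizing δ
  · have hneg : 0 < ⟪-δ, x⟫ := by
      rw [inner_neg_left]
      have := lt_of_le_of_ne (not_lt.mp hpos) (hx δ hδ)
      linarith
    have h := this (neg_mem_of_sFun_mem h0 hrefl hδ) hneg
    rwa [← neg_one_smul ℝ δ, sFun_smul (by norm_num)] at h
  have hδ0 : δ ≠ 0 := fun h => h0 (h ▸ hδ)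
  set P : Finset V := {α ∈ hfin.toFinset | 0 < ⟪α, x⟫} with hP
  have memP : ∀ {α}, α ∈ P ↔ α ∈ Δ ∧ 0 < ⟪α, x⟫ := by simp [hP]
  let ε : V → ℝ := fun α => if 0 < ⟪sFun δ α, x⟫ then 1 else -1
  let σ : V → V := fun α => if 0 < ⟪sFun δ α, x⟫ then sFun δ α else -sFun δ α
  have hεσ : ∀ α, ε α • σ α = sFun δ α := by
    intro α
    simp only [ε, σ]
    split_ifs <;> simp
  have hneg : ∀ {α}, α ∈ Δ → ¬ 0 < ⟪sFun δ α, x⟫ → 0 < ⟪-sFun δ α, x⟫ := by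
    intro α hα h
    rw [inner_neg_left]
    have := lt_of_le_of_ne (not_lt.mp h) (hx _ (hrefl δ hδ α hα))
    linarith
  have hσmem : ∀ α ∈ P, σ α ∈ P := by
    intro α hα
    rw [memP] at hα ⊢
    have hs := hrefl δ hδ α hα.1
    simp only [σ]
    split_ifs with h
    · exact ⟨hs, h⟩
    · exact ⟨neg_mem_of_sFun_mem h0 hrefl hs, hneg hα.1 h⟩
  have hsσ : ∀ α, sFun δ (σ α) = ε α • α := by
    intro α
    simp only [ε, σ]
    split_ifs <;> simp [sFun_neg_right, sFun_sFun hδ0]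
  have hε : ∀ α ∈ P, ε (σ α) = ε α := by
    intro α hα
    have hα' := (memP.mp hα).2
    have : ε (σ α) = if 0 < ⟪ε α • α, x⟫ then 1 else -1 := by rw [← hsσ]
    rw [this, real_inner_smul_left]
    simp only [ε]
    split_ifs <;> first | rfl | (exfalso; linarith)
  have hεsq : ∀ α, ε α * ε α = 1 := by
    intro α
    simp only [ε]
    split_ifs <;> norm_num
  have hσσ : ∀ α ∈ P, σ (σ α) = α := by
    intro α hα
    have h := hεσ (σ α)
    rw [hsσ, hε α hα] at h
    have h2 := congrArg (ε α • ·) h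
    simpa [smul_smul, hεsq] using h2
  have hsδ : sFun δ δ = -δ := sFun_self hδ0
  have hεδ : ε δ = -1 := by
    simp only [ε, hsδ, inner_neg_left]
    rw [if_neg (by linarith)]
  have hσδ : σ δ = δ := by
    simp only [σ, hsδ, inner_neg_left]
    rw [if_neg (by linarith), neg_neg]
  have hδP : δ ∈ P := memP.mpr ⟨hδ, hpos⟩
  have hprod : ∏ α ∈ P.erase δ, ε α = 1 := by
    refine Finset.prod_involution (fun α _ => σ α) ?_ ?_ ?_ ?_
    · intro α hα
      rw [hε α (Finset.mem_of_mem_erase hα), hεsq]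
    · intro α hα hne hfix
      refine Finset.ne_of_mem_erase hα ?_
      have hαP := memP.mp (Finset.mem_of_mem_erase hα)
      have h1 : ¬ 0 < ⟪sFun δ α, x⟫ := fun h => hne (by simp only [ε, if_pos h])
      have h2 : -sFun δ α = α := by simpa only [σ, if_neg h1] using hfix
      have h3 : (⟪α, δ⟫ / ⟪δ, δ⟫) • δ = α := by
        have h4 : (2 : ℝ) • ((⟪α, δ⟫ / ⟪δ, δ⟫) • δ) = (2 : ℝ) • α := by
          rw [smul_smul, ← mul_div_assoc]
          have h5 : (2 * ⟪α, δ⟫ / ⟪δ, δ⟫) • δ = α - sFun δ α := (sub_sub_cancel _ _).symm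
          rw [h5, sub_eq_add_neg, h2, two_smul]
        exact smul_right_injective V (two_ne_zero (α := ℝ)) h4
      have h5 := hred δ hδ (⟪α, δ⟫ / ⟪δ, δ⟫) (by rw [h3]; exact hαP.1)
      rw [h3] at h5
      refine h5.resolve_right fun h => ?_
      have := hαP.2
      rw [h, inner_neg_left] at this
      linarith
    · intro α hα
      have hαP := Finset.mem_of_mem_erase hα
      refine Finset.mem_erase.mpr ⟨fun h => Finset.ne_of_mem_erase hα ?_, hσmem α hαP⟩
      rw [← hσσ α hαP, h, hσδ]
    · intro α hα
      exact hσσ α (Finset.mem_of_mem_erase hα)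
  calc ∏ α ∈ P, ⟪α, sFun δ y⟫
      = ∏ α ∈ P, ε α * ⟪σ α, y⟫ := by
        refine Finset.prod_congr rfl fun α _ => ?_
        rw [inner_sFun_right, ← hεσ, real_inner_smul_left]
    _ = (∏ α ∈ P, ε α) * ∏ α ∈ P, ⟪σ α, y⟫ := Finset.prod_mul_distrib
    _ = -∏ α ∈ P, ⟪α, y⟫ := by
        rw [← Finset.mul_prod_erase P ε hδP, hprod, hεδ,
          Finset.prod_nbij' (g := fun α => ⟪α, y⟫) σ σ hσmem hσmem hσσ hσσ (fun _ _ => rfl)]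
        ring

/-- On the product of the positive roots, the Weyl group acts through the determinant. -/
lemma prod_pos_weylGroup [FiniteDimensional ℝ V] {Δ : Set V} (hfin : Δ.Finite)
    (h0 : (0 : V) ∉ Δ)
    (hrefl : ∀ α ∈ Δ, ∀ β ∈ Δ, sFun α β ∈ Δ)
    (hred : ∀ α ∈ Δ, ∀ t : ℝ, t • α ∈ Δ → t • α = α ∨ t • α = -α)
    {x : V} (hx : ∀ α ∈ Δ, ⟪α, x⟫ ≠ 0) {w : V ≃ₗᵢ[ℝ] V} (hw : w ∈ weylGroup Δ) (y : V) :
    ∏ α ∈ hfin.toFinset with 0 < ⟪α, x⟫, ⟪α, w y⟫ =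
      LinearMap.det (w.toLinearEquiv : V →ₗ[ℝ] V) *
        ∏ α ∈ hfin.toFinset with 0 < ⟪α, x⟫, ⟪α, y⟫ := by
  have hdet : ∀ u v : V ≃ₗᵢ[ℝ] V, LinearMap.det ((u * v).toLinearEquiv : V →ₗ[ℝ] V) =
      LinearMap.det (u.toLinearEquiv : V →ₗ[ℝ] V) *
        LinearMap.det (v.toLinearEquiv : V →ₗ[ℝ] V) :=
    fun u v => LinearMap.det_comp (u.toLinearEquiv : V →ₗ[ℝ] V) (v.toLinearEquiv : V →ₗ[ℝ] V)
  have hdet1 : LinearMap.det ((1 : V ≃ₗᵢ[ℝ] V).toLinearEquiv : V →ₗ[ℝ] V) = 1 :=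
    LinearMap.det_id
  induction hw using Subgroup.closure_induction generalizing y with
  | mem w hw =>
    obtain ⟨δ, hδ, h⟩ := hw
    rw [det_eq_neg_one_of_sFun (fun h => h0 (h ▸ hδ)) w h, h,
      prod_pos_sFun hfin h0 hrefl hred hx hδ y, neg_one_mul]
  | one => rw [hdet1, one_mul]; rfl
  | mul u v _ _ hu hv =>
    rw [hdet, mul_assoc, ← hv y, ← hu (v y)]
    rfl
  | inv u _ hu =>
    have h1 := hu (u⁻¹ y)
    have h2 : u (u⁻¹ y) = y := u.apply_symm_apply y
    have h3 := hdet u⁻¹ u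
    rw [inv_mul_cancel, hdet1] at h3
    rw [h2] at h1
    rw [h1, ← mul_assoc, ← h3, one_mul]

/-- Every reflection in the Weyl group is the reflection in a root. -/
lemma exists_smul_mem_of_reflMem_weylGroup [FiniteDimensional ℝ V] {Δ : Set V}
    (hfin : Δ.Finite) (h0 : (0 : V) ∉ Δ)
    (hrefl : ∀ α ∈ Δ, ∀ β ∈ Δ, sFun α β ∈ Δ)
    (hred : ∀ α ∈ Δ, ∀ t : ℝ, t • α ∈ Δ → t • α = α ∨ t • α = -α)
    {γ : V} (hγ : γ ≠ 0) (h : reflMem (weylGroup Δ) γ) : ∃ c : ℝ, c • γ ∈ Δ := by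
  by_contra! hc
  have hγγ : ⟪γ, γ⟫ ≠ 0 := inner_self_ne_zero.mpr hγ
  have : Finite Δ := hfin
  obtain ⟨x, hxγ, hx⟩ : ∃ x ∈ (ℝ ∙ γ)ᗮ, ∀ α : Δ, innerₛₗ ℝ (α : V) x ≠ 0 := by
    refine Module.Dual.exists_forall_mem_ne_zero_of_forall_exists (ℝ ∙ γ)ᗮ
      (fun α : Δ => innerₛₗ ℝ (α : V)) fun α => ?_
    by_contra! hα
    have h1 : (α : V) ∈ (ℝ ∙ γ)ᗮᗮ := by
      rw [Submodule.mem_orthogonal']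
      exact hα
    rw [Submodule.orthogonal_orthogonal, Submodule.mem_span_singleton] at h1
    obtain ⟨c, hc'⟩ := h1
    exact hc c (hc' ▸ α.2)
  have hx' : ∀ α ∈ Δ, ⟪α, x⟫ ≠ 0 := fun α hα => hx ⟨α, hα⟩
  obtain ⟨w, hw, hws⟩ := h
  have hwx : w x = x := by
    rw [hws, sFun, Submodule.mem_orthogonal_singleton_iff_inner_left.mp hxγ]
    simp
  have key := prod_pos_weylGroup hfin h0 hrefl hred hx' hw x
  rw [hwx, det_eq_neg_one_of_sFun hγ w hws] at key
  have hpos : 0 < ∏ α ∈ hfin.toFinset with 0 < ⟪α, x⟫, ⟪α, x⟫ :=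
    Finset.prod_pos fun α hα => (Finset.mem_filter.mp hα).2
  linarith

end Reflections

/-- A root in the plane of two simply-laced roots `α`, `β` whose sum is a root is one of
`±α`, `±β`, `±(α + β)`. -/
lemma root_eq_of_mem_plane {V : Type*} [NormedAddCommGroup V] [InnerProductSpace ℝ V]
    {Δ : Set V} (h0 : (0 : V) ∉ Δ)
    (hcrys : ∀ α ∈ Δ, ∀ β ∈ Δ, ∃ n : ℤ, 2 * ⟪β, α⟫ = (n : ℝ) * ⟪α, α⟫)
    (hsl : ∀ α ∈ Δ, ∀ β ∈ Δ, ‖α‖ = ‖β‖)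
    {α β δ : V} (hα : α ∈ Δ) (hβ : β ∈ Δ) (hαβ : α + β ∈ Δ) (hδ : δ ∈ Δ) {s t : ℝ}
    (hst : δ = s • α + t • β) :
    δ = α ∨ δ = -α ∨ δ = β ∨ δ = -β ∨ δ = α + β ∨ δ = -(α + β) := by
  have hself : ∀ η ∈ Δ, ⟪η, η⟫ = ⟪α, α⟫ := fun η hη => by
    rw [real_inner_self_eq_norm_sq, real_inner_self_eq_norm_sq, hsl η hη α hα]
  have hN : 0 < ⟪α, α⟫ := real_inner_self_pos.mpr fun h => h0 (h ▸ hα)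
  have hββ := hself β hβ
  have hs := hself _ hαβ
  have hd := hself _ hδ
  obtain ⟨m, hm⟩ := hcrys α hα δ hδ
  obtain ⟨n, hn⟩ := hcrys β hβ δ hδ
  rw [hst] at hd hm hn
  simp only [inner_add_left, inner_add_right, real_inner_smul_left, real_inner_smul_right,
    real_inner_comm α β] at hs hd hm hn
  rw [hββ] at hs hd hn
  set N := ⟪α, α⟫
  have hab : ⟪α, β⟫ = -N / 2 := by linarith
  simp only [hab] at hd hm hn
  have hm' : 2 * s - t = m := mul_right_cancel₀ hN.ne' (by linarith)
  have hn' : 2 * t - s = n := mul_right_cancel₀ hN.ne' (by linarith)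
  have hd' : s ^ 2 - s * t + t ^ 2 = 1 := mul_right_cancel₀ hN.ne' (by linarith)
  have hmn : m ^ 2 + m * n + n ^ 2 = 3 := by
    have : (m : ℝ) ^ 2 + m * n + n ^ 2 = 3 := by
      rw [← hm', ← hn']
      linarith
    exact_mod_cast this
  have hm1 : -2 ≤ m := by nlinarith [sq_nonneg (m + 2 * n)]
  have hm2 : m ≤ 2 := by nlinarith [sq_nonneg (m + 2 * n)]
  have hn1 : -2 ≤ n := by nlinarith [sq_nonneg (n + 2 * m)]
  have hn2 : n ≤ 2 := by nlinarith [sq_nonneg (n + 2 * m)]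
  have hsm : s = (2 * m + n) / 3 := by linarith
  have htm : t = (m + 2 * n) / 3 := by linarith
  rw [hst, hsm, htm]
  clear_value N
  interval_cases m <;> interval_cases n <;> first | (exfalso; omega) | skip
  · right; left; norm_num
  · right; right; right; right; right; norm_num; abel
  · right; right; left; norm_num
  · right; right; right; left; norm_num
  · right; right; right; right; left; norm_num
  · left; norm_num

/-- In a simply-laced root system, the sum of two non-opposite roots at an obtuse angle is a
root. -/
lemma add_mem_of_inner_neg {V : Type*} [NormedAddCommGroup V] [InnerProductSpace ℝ V]
    {Δ : Set V} (h0 : (0 : V) ∉ Δ)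
    (hrefl : ∀ α ∈ Δ, ∀ β ∈ Δ, sFun α β ∈ Δ)
    (hcrys : ∀ α ∈ Δ, ∀ β ∈ Δ, ∃ n : ℤ, 2 * ⟪β, α⟫ = (n : ℝ) * ⟪α, α⟫)
    (hsl : ∀ α ∈ Δ, ∀ β ∈ Δ, ‖α‖ = ‖β‖)
    {α β : V} (hα : α ∈ Δ) (hβ : β ∈ Δ) (hne : β ≠ -α) (hneg : ⟪α, β⟫ < 0) :
    α + β ∈ Δ := by
  have hN : 0 < ⟪α, α⟫ := real_inner_self_pos.mpr fun h => h0 (h ▸ hα)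
  have hββ : ⟪β, β⟫ = ⟪α, α⟫ := by
    rw [real_inner_self_eq_norm_sq, real_inner_self_eq_norm_sq, hsl β hβ α hα]
  have hsum : 0 < ⟪α + β, α + β⟫ :=
    real_inner_self_pos.mpr fun h => hne (eq_neg_of_add_eq_zero_right h)
  rw [real_inner_add_add_self, hββ] at hsum
  obtain ⟨n, hn⟩ := hcrys α hα β hβ
  rw [real_inner_comm] at hn
  have h1 : (n : ℝ) < 0 := by nlinarith
  have h2 : (-2 : ℝ) < n := by nlinarith
  have h3 : n = -1 := by
    have h4 : n < 0 := by exact_mod_cast h1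
    have h5 : -2 < n := by exact_mod_cast h2
    omega
  have h := hrefl α hα β hβ
  rw [sFun, real_inner_comm, hn, mul_div_assoc, div_self hN.ne', h3] at h
  have e : α + β = β - (((-1 : ℤ) : ℝ) * 1) • α := by
    push_cast
    module
  rwa [e]

theorem stmt4 {V : Type*} [NormedAddCommGroup V] [InnerProductSpace ℝ V]
    [FiniteDimensional ℝ V]
    (Δ : Set V) (hfin : Δ.Finite) (h0 : (0 : V) ∉ Δ)
    (hrefl : ∀ α ∈ Δ, ∀ β ∈ Δ, sFun α β ∈ Δ)
    (hcrys : ∀ α ∈ Δ, ∀ β ∈ Δ, ∃ n : ℤ, 2 * ⟪β, α⟫ = (n : ℝ) * ⟪α, α⟫)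
    (hred : ∀ α ∈ Δ, ∀ t : ℝ, t • α ∈ Δ → t • α = α ∨ t • α = -α)
    (hsl : ∀ α ∈ Δ, ∀ β ∈ Δ, ‖α‖ = ‖β‖)
    (Γ : Subgroup (V ≃ₗᵢ[ℝ] V)) (hΓ : Γ ≤ weylGroup Δ) :
    IsLarge Δ Γ ↔
      ∀ α ∈ Δ, ∀ β ∈ Δ, α + β ∈ Δ →
        reflMem Γ α ∨ reflMem Γ β ∨ reflMem Γ (α + β) := by
  constructor
  · intro hL α hα β hβ hαβ
    have hN : 0 < ⟪α, α⟫ := real_inner_self_pos.mpr fun h => h0 (h ▸ hα)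
    have hself : ∀ η ∈ Δ, ⟪η, η⟫ = ⟪α, α⟫ := fun η hη => by
      rw [real_inner_self_eq_norm_sq, real_inner_self_eq_norm_sq, hsl η hη α hα]
    have hs := hself _ hαβ
    rw [real_inner_add_add_self, hself β hβ] at hs
    have hne1 : β ≠ α := by
      rintro rfl
      linarith
    have hne2 : β ≠ -α := by
      rintro rfl
      exact h0 (by simpa using hαβ)
    obtain ⟨γ, hγ, ⟨s, t, hst⟩, w, hw, hws⟩ :=
      hL α hα β hβ hne1 hne2 (by linarith)
    obtain ⟨c, hc⟩ := exists_smul_mem_of_reflMem_weylGroup hfin h0 hrefl hred hγ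
      ⟨w, hΓ hw, hws⟩
    have hc0 : c ≠ 0 := by
      rintro rfl
      exact h0 (by simpa using hc)
    have hmem : reflMem Γ (c • γ) := (reflMem_smul hc0 γ).mpr ⟨w, hw, hws⟩
    have hplane : c • γ = (c * s) • α + (c * t) • β := by
      rw [hst]
      module
    rcases root_eq_of_mem_plane h0 hcrys hsl hα hβ hαβ hc hplane with
      h | h | h | h | h | h <;> rw [h] at hmem
    · exact Or.inl hmem
    · exact Or.inl ((reflMem_neg α).mp hmem)
    · exact Or.inr (Or.inl hmem)
    · exact Or.inr (Or.inl ((reflMem_neg β).mp hmem))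
    · exact Or.inr (Or.inr hmem)
    · exact Or.inr (Or.inr ((reflMem_neg (α + β)).mp hmem))
  · intro hA α hα β hβ hne1 hne2 hαβ
    have hα0 : α ≠ 0 := fun h => h0 (h ▸ hα)
    have hβ0 : β ≠ 0 := fun h => h0 (h ▸ hβ)
    rcases lt_or_gt_of_ne hαβ with hlt | hgt
    · have hsum := add_mem_of_inner_neg h0 hrefl hcrys hsl hα hβ hne2 hlt
      rcases hA α hα β hβ hsum with h | h | h
      · exact ⟨α, hα0, ⟨1, 0, by simp⟩, h⟩
      · exact ⟨β, hβ0, ⟨0, 1, by simp⟩, h⟩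
      · exact ⟨α + β, fun h => h0 (h ▸ hsum), ⟨1, 1, by simp⟩, h⟩
    · have hβ' := neg_mem_of_sFun_mem h0 hrefl hβ
      have hsum := add_mem_of_inner_neg h0 hrefl hcrys hsl hα hβ' (by simpa using hne1)
        (by rw [inner_neg_right]; linarith)
      rcases hA α hα (-β) hβ' hsum with h | h | h
      · exact ⟨α, hα0, ⟨1, 0, by simp⟩, h⟩
      · exact ⟨-β, neg_ne_zero.mpr hβ0, ⟨0, -1, by simp⟩, h⟩
      · exact ⟨α + -β, fun h => h0 (h ▸ hsum), ⟨1, -1, by simp⟩, h⟩
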